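/- Let a ∈ I₁ with a ∉ K[H] + F. Then the centralizer Cen_{I₁}(a) is a finitely generated module over the subalgebra K[a]; in particular, Cen_{I₁}(a) is a finitely generated K-algebra which is left and right Noetherian. -/

import Mathlib

open Polynomial

noncomputable section
set_option synthInstance.maxHeartbeats 1000000
set_option maxHeartbeats 1000000
set_option linter.unusedSectionVars false

variable (K : Type*) [Field K] [CharZero K]

/-- The derivative operator `∂ = d/dx` on `K[x]`. -/
def derOp : Module.End K (Polynomial K) := Polynomial.derivative

/-- The multiplication-by-`x` operator on `K[x]`. -/
def xOp : Module.End K (Polynomial K) := LinearMap.mulLeft K Polynomial.X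

/-- The integration operator `∫`, determined by `∫ xⁿ = xⁿ⁺¹/(n+1)`. -/
def intOp : Module.End K (Polynomial K) :=
  (Polynomial.basisMonomials K).constr K fun n => ((n : K) + 1)⁻¹ • X ^ (n + 1)

/-- The algebra `I₁` of polynomial integro-differential operators: the subalgebra of
`End_K(K[x])` generated by `x`, `∂` and `∫`. -/
def I1 : Subalgebra K (Module.End K (Polynomial K)) :=
  Algebra.adjoin K {xOp K, derOp K, intOp K}

/-- `e_{ij} := ∫^i ∂^j − ∫^{i+1} ∂^{j+1}`. -/
def eOp (i j : ℕ) : Module.End K (Polynomial K) :=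
  intOp K ^ i * derOp K ^ j - intOp K ^ (i + 1) * derOp K ^ (j + 1)

/-- `F`, the `K`-linear span of the `e_{ij}`; it is the (two-sided) ideal of compact
operators of `I₁`. -/
def Fset : Submodule K (Module.End K (Polynomial K)) :=
  Submodule.span K {f | ∃ i j, f = eOp K i j}

lemma xOp_mem : xOp K ∈ I1 K := Algebra.subset_adjoin (by simp)
lemma derOp_mem : derOp K ∈ I1 K := Algebra.subset_adjoin (by simp)
lemma intOp_mem : intOp K ∈ I1 K := Algebra.subset_adjoin (by simp)

lemma eOp_mem (i j : ℕ) : eOp K i j ∈ I1 K :=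
  sub_mem (mul_mem (pow_mem (intOp_mem K) i) (pow_mem (derOp_mem K) j))
    (mul_mem (pow_mem (intOp_mem K) (i + 1)) (pow_mem (derOp_mem K) (j + 1)))

/-- `e_{ij}` as an element of the ring `I₁`. -/
def eI (i j : ℕ) : I1 K := ⟨eOp K i j, eOp_mem K i j⟩

/-- `∂` as an element of the ring `I₁`. -/
def derI : I1 K := ⟨derOp K, derOp_mem K⟩

/-- `∫` as an element of the ring `I₁`. -/
def intI : I1 K := ⟨intOp K, intOp_mem K⟩

/-- `H := ∂ ∘ x` (first multiply by `x`, then differentiate). -/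
def hOp : Module.End K (Polynomial K) := derOp K * xOp K

/-- `K[H]`, the unital subalgebra of `I₁` generated by `H`. -/
def KH : Subalgebra K (Module.End K (Polynomial K)) := Algebra.adjoin K {hOp K}

/-- The action of `a ∈ I₁` on a left `I₁`-module `M`, as a `K`-linear map `a_M : M → M`. -/
def actMap (a : I1 K) (M : Type*) [AddCommGroup M] [Module (I1 K) M] [Module K M]
    [SMulCommClass K (I1 K) M] : M →ₗ[K] M where
  toFun m := a • m
  map_add' := smul_add a
  map_smul' k m := (smul_comm k a m).symm

/-- Right multiplication `b ↦ b * a` in a ring `R`, as a homomorphism of left `R`-modules. -/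
def rmulMap (R : Type*) [Ring R] (a : R) : R →ₗ[R] R where
  toFun b := b * a
  map_add' b c := add_mul b c a
  map_smul' c b := by simp [smul_eq_mul, mul_assoc]

/-- Left multiplication `b ↦ a * b` in a ring `R`, as a homomorphism of right `R`-modules
(i.e. of left `Rᵐᵒᵖ`-modules). -/
def lmulMap (R : Type*) [Ring R] (a : R) : R →ₗ[Rᵐᵒᵖ] R where
  toFun b := a * b
  map_add' b c := mul_add a b c
  map_smul' c b := by simp [MulOpposite.smul_eq_mul_unop, mul_assoc]

/-- The centralizer `Cen_{I₁}(a) = {b ∈ I₁ : ab = ba}` of `a` in `I₁`, as a subalgebra of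
`End_K(K[x])`. -/
def Cen (a : Module.End K (Polynomial K)) : Subalgebra K (Module.End K (Polynomial K)) :=
  I1 K ⊓ Subalgebra.centralizer K {a}

/-- `Cen_F(a) = {f ∈ F : af = fa}`, a `K`-subspace of `End_K(K[x])`. -/
def CenF (a : Module.End K (Polynomial K)) : Submodule K (Module.End K (Polynomial K)) :=
  Fset K ⊓ Subalgebra.toSubmodule (Subalgebra.centralizer K {a})


lemma commute_aeval_of_commute {k R : Type*} [Field k] [Ring R] [Algebra k R] {α c : R}
    (h : Commute α c) (p : k[X]) : Commute (aeval α p) c :=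
  (Algebra.commute_of_mem_adjoin_singleton_of_commute (aeval_mem_adjoin_singleton k α)
    h.symm).symm

lemma isNoetherianRing_of_aeval_generators {k R : Type*} [Field k] [Ring R] [Algebra k R] {α : R}
    {n : ℕ} {g : Fin n → R} (h : ∀ c : R, ∃ p : Fin n → k[X], c = ∑ i, aeval α (p i) * g i) :
    IsNoetherianRing R := by
  let _ : Module k[X] R := Module.compHom R (aeval α : k[X] →ₐ[k] R).toRingHom
  have hsmul : ∀ (p : k[X]) (r : R), p • r = aeval α p * r := fun _ _ => rfl
  have : IsScalarTower k[X] R R := ⟨fun p r s => by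
    rw [hsmul, hsmul, smul_eq_mul, smul_eq_mul, mul_assoc]⟩
  have : Module.Finite k[X] R := by
    refine ⟨Submodule.fg_iff_exists_fin_generating_family.2 ⟨n, g, eq_top_iff.2 fun c _ => ?_⟩⟩
    obtain ⟨p, rfl⟩ := h c
    exact (Submodule.mem_span_range_iff_exists_fun _).2 ⟨p, rfl⟩
  exact isNoetherian_of_tower k[X] (isNoetherian_of_isNoetherianRing_of_finite k[X] R)

lemma isNoetherianRing_op_of_aeval_generators {k R : Type*} [Field k] [Ring R] [Algebra k R]
    {α : R} (hα : ∀ c, Commute α c) {n : ℕ} {g : Fin n → R}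
    (h : ∀ c : R, ∃ p : Fin n → k[X], c = ∑ i, aeval α (p i) * g i) :
    IsNoetherianRing Rᵐᵒᵖ := by
  refine isNoetherianRing_of_aeval_generators (k := k) (α := MulOpposite.op α)
    (g := fun i => MulOpposite.op (g i)) fun c => ?_
  obtain ⟨p, hp⟩ := h c.unop
  refine ⟨p, MulOpposite.unop_injective ?_⟩
  rw [hp, Finset.unop_sum]
  refine Finset.sum_congr rfl fun i _ => ?_
  rw [aeval_op_apply, MulOpposite.unop_mul, MulOpposite.unop_op, MulOpposite.unop_op,
    (commute_aeval_of_commute (hα _) _).eq]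

lemma fg_of_aeval_generators {k R : Type*} [Field k] [Ring R] [Algebra k R] {S : Subalgebra k R}
    {α : R} (hα : α ∈ S) {n : ℕ} {g : Fin n → R} (hg : ∀ i, g i ∈ S)
    (h : ∀ c ∈ S, ∃ p : Fin n → k[X], c = ∑ i, aeval α (p i) * g i) : S.FG := by
  refine Subalgebra.fg_def.2 ⟨insert α (Set.range g), (Set.finite_range g).insert α,
    le_antisymm (Algebra.adjoin_le ?_) fun c hc => ?_⟩
  · rintro _ (rfl | ⟨i, rfl⟩)
    exacts [hα, hg i]
  · obtain ⟨p, rfl⟩ := h c hc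
    refine sum_mem fun i _ => mul_mem ?_ (Algebra.subset_adjoin (Or.inr ⟨i, rfl⟩))
    exact Algebra.adjoin_mono (by simp) (aeval_mem_adjoin_singleton k α)

section Centralizers
variable {K}

/-- The basis `xⁿ / n!` of `K[x]`, on which `∫` and `∂` act as shifts. -/
def divPowBasis (K : Type*) [Field K] [CharZero K] : Module.Basis ℕ K K[X] :=
  (Polynomial.basisMonomials K).isUnitSMul (w := fun n => ((n.factorial : K))⁻¹)
    fun n => (IsUnit.mk0 _ (inv_ne_zero (Nat.cast_ne_zero.2 n.factorial_ne_zero)))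

local notation "ep" => divPowBasis K

lemma divPowBasis_apply (n : ℕ) : ep n = ((n.factorial : K))⁻¹ • (X ^ n : K[X]) := by
  simp [divPowBasis, Module.Basis.isUnitSMul_apply, X_pow_eq_monomial]

lemma intOp_X_pow (n : ℕ) : intOp K (X ^ n) = ((n : K) + 1)⁻¹ • (X ^ (n + 1) : K[X]) := by
  have h := (Polynomial.basisMonomials K).constr_basis K
    (fun n : ℕ => ((n : K) + 1)⁻¹ • (X ^ (n + 1) : K[X])) n
  simpa [intOp, X_pow_eq_monomial] using h

lemma intOp_divPow (n : ℕ) : intOp K (ep n) = ep (n + 1) := by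
  rw [divPowBasis_apply, divPowBasis_apply, map_smul, intOp_X_pow, smul_smul, Nat.factorial_succ]
  congr 1
  push_cast
  rw [mul_inv, mul_comm]

lemma derOp_divPow_zero : derOp K (ep 0) = 0 := by
  rw [divPowBasis_apply]; simp [derOp]

lemma derOp_divPow_succ (n : ℕ) : derOp K (ep (n + 1)) = ep n := by
  have h : ((n : K) + 1) ≠ 0 := by exact_mod_cast n.succ_ne_zero
  rw [divPowBasis_apply, divPowBasis_apply, map_smul, derOp, derivative_X_pow, Nat.factorial_succ,
    ← smul_eq_C_mul, smul_smul]
  congr 1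
  push_cast
  field_simp

lemma xOp_divPow (n : ℕ) : xOp K (ep n) = ((n : K) + 1) • ep (n + 1) := by
  have h : ((n : K) + 1) ≠ 0 := by exact_mod_cast n.succ_ne_zero
  rw [divPowBasis_apply, divPowBasis_apply, map_smul, xOp, Nat.factorial_succ, smul_smul,
    LinearMap.mulLeft_apply, ← pow_succ']
  congr 1
  push_cast
  field_simp

lemma hOp_divPow (n : ℕ) : hOp K (ep n) = ((n : K) + 1) • ep n := by
  rw [hOp, Module.End.mul_apply, xOp_divPow, map_smul, derOp_divPow_succ]

lemma aeval_hOp_divPow (p : K[X]) (n : ℕ) :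
    aeval (hOp K) p (ep n) = p.eval ((n : K) + 1) • ep n := by
  induction p using Polynomial.induction_on' with
  | add p q hp hq => simp [hp, hq, add_smul]
  | monomial k c =>
    have h : ∀ k : ℕ, (hOp K ^ k) (ep n) = ((n : K) + 1) ^ k • ep n := by
      intro k
      induction k with
      | zero => simp
      | succ k ih => rw [pow_succ', Module.End.mul_apply, ih, map_smul, hOp_divPow, smul_smul,
          pow_succ]
    rw [aeval_monomial, Module.End.mul_apply, h, eval_monomial, map_smul,
      Module.algebraMap_end_apply, smul_smul, mul_comm]

lemma intOp_pow_divPow (i n : ℕ) : (intOp K ^ i) (ep n) = ep (n + i) := by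
  induction i with
  | zero => simp
  | succ i ih => rw [pow_succ', Module.End.mul_apply, ih, intOp_divPow, add_assoc]

lemma derOp_pow_divPow_add (i n : ℕ) : (derOp K ^ i) (ep (n + i)) = ep n := by
  induction i with
  | zero => simp
  | succ i ih => rw [pow_succ, Module.End.mul_apply, ← add_assoc, derOp_divPow_succ, ih]

lemma derOp_pow_divPow_of_lt {i n : ℕ} (h : n < i) : (derOp K ^ i) (ep n) = 0 := by
  obtain ⟨k, rfl⟩ := Nat.exists_eq_add_of_lt h
  rw [show n + k + 1 = k + (1 + n) by ring, pow_add, pow_add, Module.End.mul_apply,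
    Module.End.mul_apply]
  have := derOp_pow_divPow_add (K := K) n 0
  rw [zero_add] at this
  rw [this, pow_one, derOp_divPow_zero, map_zero]

lemma eOp_divPow_of_ne {i j n : ℕ} (h : n ≠ j) : eOp K i j (ep n) = 0 := by
  rw [eOp, LinearMap.sub_apply, Module.End.mul_apply, Module.End.mul_apply]
  rcases lt_or_gt_of_ne h with h | h
  · rw [derOp_pow_divPow_of_lt h, derOp_pow_divPow_of_lt (by omega)]; simp
  · obtain ⟨k, rfl⟩ := Nat.exists_eq_add_of_lt h
    have h1 : j + k + 1 = (k + 1) + j := by ring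
    have h2 : j + k + 1 = k + (j + 1) := by ring
    rw [h2, derOp_pow_divPow_add, ← h2, h1, derOp_pow_divPow_add, intOp_pow_divPow,
      intOp_pow_divPow, sub_eq_zero]
    congr 1
    ring

lemma eOp_divPow_self (i j : ℕ) : eOp K i j (ep j) = ep i := by
  have := derOp_pow_divPow_add (K := K) j 0
  rw [zero_add] at this
  rw [eOp, LinearMap.sub_apply, Module.End.mul_apply, Module.End.mul_apply, this,
    derOp_pow_divPow_of_lt (Nat.lt_succ_self j), intOp_pow_divPow]
  simp

lemma eOp_divPow (i j n : ℕ) : eOp K i j (ep n) = if n = j then ep i else 0 := by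
  split_ifs with h
  · rw [h, eOp_divPow_self]
  · exact eOp_divPow_of_ne h

lemma eOp_mem_Fset (i j : ℕ) : eOp K i j ∈ Fset K := Submodule.subset_span ⟨i, j, rfl⟩

lemma Fset_eventually_zero {f : Module.End K K[X]} (hf : f ∈ Fset K) :
    ∃ n₀, ∀ n ≥ n₀, f (ep n) = 0 := by
  induction hf using Submodule.span_induction with
  | mem f hf =>
    obtain ⟨i, j, rfl⟩ := hf
    exact ⟨j + 1, fun n hn => eOp_divPow_of_ne (by omega)⟩
  | zero => exact ⟨0, by simp⟩
  | add f g _ _ hf hg =>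
    obtain ⟨m, hm⟩ := hf
    obtain ⟨n, hn⟩ := hg
    exact ⟨max m n, fun k hk => by
      simp [hm k (le_trans (le_max_left _ _) hk), hn k (le_trans (le_max_right _ _) hk)]⟩
  | smul c f _ hf =>
    obtain ⟨m, hm⟩ := hf
    exact ⟨m, fun k hk => by simp [hm k hk]⟩

/-- The map `(pᵢ) ↦ ∑ ∫ⁱ pᵢ(H)`. -/
def upperPart (K : Type*) [Field K] [CharZero K] : (ℕ →₀ K[X]) →ₗ[K] Module.End K K[X] :=
  Finsupp.lsum K fun i => LinearMap.mulLeft K (intOp K ^ i) ∘ₗ (aeval (hOp K)).toLinearMap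

/-- The map `(qᵢ) ↦ ∑ qᵢ(H) ∂ⁱ`. -/
def lowerPart (K : Type*) [Field K] [CharZero K] : (ℕ →₀ K[X]) →ₗ[K] Module.End K K[X] :=
  Finsupp.lsum K fun i => LinearMap.mulRight K (derOp K ^ i) ∘ₗ (aeval (hOp K)).toLinearMap

lemma upperPart_apply (p : ℕ →₀ K[X]) :
    upperPart K p = ∑ i ∈ p.support, intOp K ^ i * aeval (hOp K) (p i) := by
  simp [upperPart, Finsupp.sum]

lemma lowerPart_apply (p : ℕ →₀ K[X]) :
    lowerPart K p = ∑ i ∈ p.support, aeval (hOp K) (p i) * derOp K ^ i := by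
  simp [lowerPart, Finsupp.sum]

/-- The sum `∑ ∫ⁱ K[H] + ∑ K[H] ∂ⁱ + F`, which contains `I₁`. -/
def normalForms (K : Type*) [Field K] [CharZero K] : Submodule K (Module.End K K[X]) :=
  (upperPart K).range ⊔ (lowerPart K).range ⊔ Fset K

lemma intOp_pow_mul_mem_normalForms (i : ℕ) (p : K[X]) :
    intOp K ^ i * aeval (hOp K) p ∈ normalForms K :=
  Submodule.mem_sup_left (Submodule.mem_sup_left
    ⟨Finsupp.single i p, by simp [upperPart]⟩)

lemma mul_derOp_pow_mem_normalForms (i : ℕ) (p : K[X]) :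
    aeval (hOp K) p * derOp K ^ i ∈ normalForms K :=
  Submodule.mem_sup_left (Submodule.mem_sup_right
    ⟨Finsupp.single i p, by simp [lowerPart]⟩)

lemma eOp_mem_normalForms (i j : ℕ) : eOp K i j ∈ normalForms K :=
  Submodule.mem_sup_right (eOp_mem_Fset i j)

lemma end_ext_divPow {f g : Module.End K K[X]} (h : ∀ n, f (ep n) = g (ep n)) : f = g :=
  (divPowBasis K).ext h

lemma derOp_mul_intOp : derOp K * intOp K = 1 :=
  end_ext_divPow fun n => by
    rw [Module.End.mul_apply, intOp_divPow, derOp_divPow_succ, Module.End.one_apply]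

lemma derOp_mul_aeval (p : K[X]) :
    derOp K * aeval (hOp K) p = aeval (hOp K) (p.comp (X + 1)) * derOp K :=
  end_ext_divPow fun n => by
    rw [Module.End.mul_apply, Module.End.mul_apply, aeval_hOp_divPow, map_smul]
    cases n with
    | zero => simp [derOp_divPow_zero]
    | succ n => simp [derOp_divPow_succ, aeval_hOp_divPow]

lemma intOp_mul_aeval (p : K[X]) :
    intOp K * aeval (hOp K) p = aeval (hOp K) (p.comp (X - 1)) * intOp K :=
  end_ext_divPow fun n => by
    rw [Module.End.mul_apply, Module.End.mul_apply, aeval_hOp_divPow, map_smul, intOp_divPow,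
      aeval_hOp_divPow]
    simp

lemma hOp_mul_intOp_pow (i : ℕ) :
    hOp K * intOp K ^ i = intOp K ^ i * aeval (hOp K) (X + C (i : K)) :=
  end_ext_divPow fun n => by
    rw [Module.End.mul_apply, Module.End.mul_apply, aeval_hOp_divPow, map_smul, intOp_pow_divPow,
      hOp_divPow]
    congr 1
    simp
    ring

lemma aeval_hOp_mul_eOp (p : K[X]) (i j : ℕ) :
    aeval (hOp K) p * eOp K i j = p.eval ((i : K) + 1) • eOp K i j :=
  end_ext_divPow fun n => by
    rw [Module.End.mul_apply, LinearMap.smul_apply, eOp_divPow]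
    split_ifs
    · rw [aeval_hOp_divPow]
    · simp

lemma intOp_mul_eOp (i j : ℕ) : intOp K * eOp K i j = eOp K (i + 1) j :=
  end_ext_divPow fun n => by
    rw [Module.End.mul_apply, eOp_divPow, eOp_divPow]
    split_ifs
    · rw [intOp_divPow]
    · simp

lemma derOp_mul_eOp_zero (j : ℕ) : derOp K * eOp K 0 j = 0 :=
  end_ext_divPow fun n => by
    rw [Module.End.mul_apply, eOp_divPow]
    split_ifs
    · rw [derOp_divPow_zero]; rfl
    · simp

lemma derOp_mul_eOp_succ (i j : ℕ) : derOp K * eOp K (i + 1) j = eOp K i j :=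
  end_ext_divPow fun n => by
    rw [Module.End.mul_apply, eOp_divPow, eOp_divPow]
    split_ifs
    · rw [derOp_divPow_succ]
    · simp

lemma intOp_mul_derOp_pow_succ (i : ℕ) :
    intOp K * derOp K ^ (i + 1) = derOp K ^ i - eOp K 0 i := by
  simp [eOp]

lemma mul_mem_normalForms_of_generators {y : Module.End K K[X]}
    (hu : ∀ (i : ℕ) (p : K[X]), y * (intOp K ^ i * aeval (hOp K) p) ∈ normalForms K)
    (hl : ∀ (i : ℕ) (p : K[X]), y * (aeval (hOp K) p * derOp K ^ i) ∈ normalForms K)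
    (he : ∀ i j, y * eOp K i j ∈ normalForms K) {s : Module.End K K[X]}
    (hs : s ∈ normalForms K) : y * s ∈ normalForms K := by
  have : normalForms K ≤ (normalForms K).comap (LinearMap.mulLeft K y) := by
    conv_lhs => rw [normalForms]
    refine sup_le (sup_le ?_ ?_) ?_
    · rintro _ ⟨p, rfl⟩
      rw [upperPart_apply]
      exact sum_mem fun i _ => hu i _
    · rintro _ ⟨p, rfl⟩
      rw [lowerPart_apply]
      exact sum_mem fun i _ => hl i _
    · refine Submodule.span_le.2 ?_
      rintro _ ⟨i, j, rfl⟩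
      exact he i j
  exact this hs

lemma intOp_mul_mem_normalForms {s : Module.End K K[X]} (hs : s ∈ normalForms K) :
    intOp K * s ∈ normalForms K := by
  refine mul_mem_normalForms_of_generators (fun i p => ?_) (fun i p => ?_) (fun i j => ?_) hs
  · rw [← mul_assoc, ← pow_succ']
    exact intOp_pow_mul_mem_normalForms _ _
  · cases i with
    | zero => simpa using intOp_pow_mul_mem_normalForms 1 p
    | succ i =>
      rw [← mul_assoc, intOp_mul_aeval, mul_assoc, intOp_mul_derOp_pow_succ, mul_sub,
        aeval_hOp_mul_eOp]
      exact sub_mem (mul_derOp_pow_mem_normalForms _ _)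
        (Submodule.smul_mem _ _ (eOp_mem_normalForms _ _))
  · rw [intOp_mul_eOp]
    exact eOp_mem_normalForms _ _

lemma derOp_mul_mem_normalForms {s : Module.End K K[X]} (hs : s ∈ normalForms K) :
    derOp K * s ∈ normalForms K := by
  refine mul_mem_normalForms_of_generators (fun i p => ?_) (fun i p => ?_) (fun i j => ?_) hs
  · cases i with
    | zero =>
      rw [pow_zero, one_mul, derOp_mul_aeval]
      simpa using mul_derOp_pow_mem_normalForms 1 (p.comp (X + 1))
    | succ i =>
      rw [← mul_assoc, pow_succ', ← mul_assoc, derOp_mul_intOp, one_mul]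
      exact intOp_pow_mul_mem_normalForms _ _
  · rw [← mul_assoc, derOp_mul_aeval, mul_assoc, ← pow_succ']
    exact mul_derOp_pow_mem_normalForms _ _
  · cases i with
    | zero => rw [derOp_mul_eOp_zero]; exact zero_mem _
    | succ i => rw [derOp_mul_eOp_succ]; exact eOp_mem_normalForms _ _

lemma hOp_mul_mem_normalForms {s : Module.End K K[X]} (hs : s ∈ normalForms K) :
    hOp K * s ∈ normalForms K := by
  refine mul_mem_normalForms_of_generators (fun i p => ?_) (fun i p => ?_) (fun i j => ?_) hs
  · rw [← mul_assoc, hOp_mul_intOp_pow, mul_assoc, ← map_mul]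
    exact intOp_pow_mul_mem_normalForms _ _
  · have h : hOp K * aeval (hOp K) p = aeval (hOp K) (X * p) := by simp
    rw [← mul_assoc, h]
    exact mul_derOp_pow_mem_normalForms _ _
  · have h := aeval_hOp_mul_eOp (K := K) X i j
    rw [aeval_X] at h
    rw [h]
    exact Submodule.smul_mem _ _ (eOp_mem_normalForms _ _)

lemma xOp_eq : xOp K = intOp K * hOp K :=
  end_ext_divPow fun n => by
    rw [Module.End.mul_apply, hOp_divPow, xOp_divPow, map_smul, intOp_divPow]

lemma I1_le_normalForms {a : Module.End K K[X]} (ha : a ∈ I1 K) : a ∈ normalForms K := by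
  have key : ∀ s ∈ normalForms K, a * s ∈ normalForms K := by
    rw [I1] at ha
    induction ha using Algebra.adjoin_induction with
    | mem y hy =>
      intro s hs
      simp only [Set.mem_insert_iff, Set.mem_singleton_iff] at hy
      rcases hy with rfl | rfl | rfl
      · rw [xOp_eq, mul_assoc]
        exact intOp_mul_mem_normalForms (hOp_mul_mem_normalForms hs)
      · exact derOp_mul_mem_normalForms hs
      · exact intOp_mul_mem_normalForms hs
    | algebraMap r =>
      intro s hs
      rw [← Algebra.smul_def]
      exact Submodule.smul_mem _ _ hs
    | add x y _ _ hx hy =>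
      intro s hs
      rw [add_mul]
      exact add_mem (hx s hs) (hy s hs)
    | mul x y _ _ hx hy =>
      intro s hs
      rw [mul_assoc]
      exact hx _ (hy s hs)
  have h1 : (1 : Module.End K K[X]) ∈ normalForms K := by
    simpa using intOp_pow_mul_mem_normalForms (K := K) 0 1
  simpa using key 1 h1

lemma exists_normalForm {a : Module.End K K[X]} (ha : a ∈ I1 K) :
    ∃ p q : ℕ →₀ K[X], ∃ f ∈ Fset K, a = upperPart K p + lowerPart K q + f := by
  obtain ⟨y, hy, f, hf, rfl⟩ := Submodule.mem_sup.1 (I1_le_normalForms ha)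
  obtain ⟨_, ⟨p, rfl⟩, _, ⟨q, rfl⟩, rfl⟩ := Submodule.mem_sup.1 hy
  exact ⟨p, q, f, hf, rfl⟩

/-- `f` and `g` are transposes of each other with respect to the basis `xⁿ / n!`. -/
def IsTranspose (f g : Module.End K K[X]) : Prop :=
  ∀ u v, (divPowBasis K).toDual (f u) v = (divPowBasis K).toDual u (g v)

namespace IsTranspose
variable {f g f' g' : Module.End K K[X]}

lemma of_basis
    (h : ∀ i j, (divPowBasis K).toDual (f (ep i)) (ep j) =
      (divPowBasis K).toDual (ep i) (g (ep j))) :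
    IsTranspose f g := by
  have : (divPowBasis K).toDual ∘ₗ f = (LinearMap.lcomp K K g) ∘ₗ (divPowBasis K).toDual :=
    (divPowBasis K).ext fun i => (divPowBasis K).ext fun j => h i j
  intro u v
  exact LinearMap.congr_fun (LinearMap.congr_fun this u) v

lemma symm (h : IsTranspose f g) : IsTranspose g f := by
  have hs : ∀ u v, (divPowBasis K).toDual u v = (divPowBasis K).toDual v u := by
    have : (divPowBasis K).toDual = (divPowBasis K).toDual.flip :=
      (divPowBasis K).ext fun i => (divPowBasis K).ext fun j => by
        rw [LinearMap.flip_apply, Module.Basis.toDual_apply, Module.Basis.toDual_apply]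
        simp only [eq_comm]
    intro u v
    exact LinearMap.congr_fun (LinearMap.congr_fun this u) v
  intro u v
  rw [hs, ← h v u, hs]

lemma add (h : IsTranspose f g) (h' : IsTranspose f' g') : IsTranspose (f + f') (g + g') :=
  fun u v => by simp [h u v, h' u v]

lemma sub (h : IsTranspose f g) (h' : IsTranspose f' g') : IsTranspose (f - f') (g - g') :=
  fun u v => by simp [h u v, h' u v]

lemma smul (c : K) (h : IsTranspose f g) : IsTranspose (c • f) (c • g) :=
  fun u v => by simp [h u v]

lemma mul (h : IsTranspose f g) (h' : IsTranspose f' g') : IsTranspose (f * f') (g' * g) :=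
  fun u v => by rw [Module.End.mul_apply, Module.End.mul_apply, h, h']

lemma zero : IsTranspose (0 : Module.End K K[X]) 0 := fun u v => by simp

lemma one : IsTranspose (1 : Module.End K K[X]) 1 := fun u v => by simp

lemma pow (h : IsTranspose f g) (n : ℕ) : IsTranspose (f ^ n) (g ^ n) := by
  induction n with
  | zero => simpa using one
  | succ n ih => rw [pow_succ, pow_succ']; exact ih.mul h

lemma sum {ι : Type*} {s : Finset ι} {f g : ι → Module.End K K[X]}
    (h : ∀ i ∈ s, IsTranspose (f i) (g i)) : IsTranspose (∑ i ∈ s, f i) (∑ i ∈ s, g i) := by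
  classical
  induction s using Finset.induction_on with
  | empty => simpa using zero
  | insert i s hi ih =>
    rw [Finset.sum_insert hi, Finset.sum_insert hi]
    exact (h i (by simp)).add (ih fun j hj => h j (by simp [hj]))

lemma aeval (h : IsTranspose f g) (p : K[X]) :
    IsTranspose (Polynomial.aeval f p) (Polynomial.aeval g p) := by
  rw [aeval_eq_sum_range, aeval_eq_sum_range]
  exact sum fun i _ => (h.pow i).smul _

lemma left_unique (h : IsTranspose f g) (h' : IsTranspose f' g) : f = f' := by
  refine LinearMap.ext fun u => LinearMap.ker_eq_bot.1 (divPowBasis K).toDual_ker ?_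
  refine LinearMap.ext fun v => ?_
  rw [h, h']

lemma right_unique (h : IsTranspose f g) (h' : IsTranspose f g') : g = g' :=
  h.symm.left_unique h'.symm

end IsTranspose

lemma isTranspose_intOp_derOp : IsTranspose (intOp K) (derOp K) :=
  IsTranspose.of_basis fun i j => by
    rw [intOp_divPow]
    cases j with
    | zero => rw [derOp_divPow_zero, Module.Basis.toDual_apply]; simp
    | succ j => rw [derOp_divPow_succ, Module.Basis.toDual_apply, Module.Basis.toDual_apply]; simp

lemma isTranspose_hOp : IsTranspose (hOp K) (hOp K) :=
  IsTranspose.of_basis fun i j => by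
    rw [hOp_divPow, hOp_divPow, map_smul, map_smul, LinearMap.smul_apply,
      Module.Basis.toDual_apply]
    split_ifs with h
    · rw [h]
    · simp

lemma isTranspose_eOp (i j : ℕ) : IsTranspose (eOp K i j) (eOp K j i) := by
  have h := isTranspose_intOp_derOp (K := K)
  exact ((h.pow i).mul (h.symm.pow j)).sub ((h.pow (i + 1)).mul (h.symm.pow (j + 1)))

lemma exists_isTranspose_of_mem_Fset {f : Module.End K K[X]} (hf : f ∈ Fset K) :
    ∃ g ∈ Fset K, IsTranspose f g := by
  induction hf using Submodule.span_induction with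
  | mem f hf =>
    obtain ⟨i, j, rfl⟩ := hf
    exact ⟨_, eOp_mem_Fset j i, isTranspose_eOp i j⟩
  | zero => exact ⟨0, zero_mem _, IsTranspose.zero⟩
  | add f f' _ _ hf hf' =>
    obtain ⟨g, hg, h⟩ := hf
    obtain ⟨g', hg', h'⟩ := hf'
    exact ⟨_, add_mem hg hg', h.add h'⟩
  | smul c f _ hf =>
    obtain ⟨g, hg, h⟩ := hf
    exact ⟨_, Submodule.smul_mem _ c hg, h.smul c⟩

lemma isTranspose_upperPart (p : ℕ →₀ K[X]) : IsTranspose (upperPart K p) (lowerPart K p) := by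
  rw [upperPart_apply, lowerPart_apply]
  exact IsTranspose.sum fun i _ => (isTranspose_intOp_derOp.pow i).mul (isTranspose_hOp.aeval _)

lemma exists_isTranspose {a : Module.End K K[X]} (ha : a ∈ I1 K) : ∃ b, IsTranspose a b := by
  obtain ⟨p, q, f, hf, rfl⟩ := exists_normalForm ha
  obtain ⟨g, -, hg⟩ := exists_isTranspose_of_mem_Fset hf
  exact ⟨_, ((isTranspose_upperPart p).add (isTranspose_upperPart q).symm).add hg⟩

/-- `a` eventually raises degrees by a fixed positive amount. -/
def RaisesDegree (a : Module.End K K[X]) : Prop :=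
  ∃ m > 0, ∃ n₀, ∀ n ≥ n₀, ∃ c : K, c ≠ 0 ∧
    a (ep n) - c • ep (n + m) ∈ Submodule.span K (ep '' Set.Iio (n + m))

lemma exists_forall_ge_eval_ne_zero {p : K[X]} (hp : p ≠ 0) :
    ∃ n₀ : ℕ, ∀ n ≥ n₀, p.eval ((n : K) + 1) ≠ 0 := by
  have hfin : {n : ℕ | p.IsRoot ((n : K) + 1)}.Finite :=
    (p.finite_setOfPred_isRoot hp).preimage (f := fun n : ℕ => (n : K) + 1)
      (fun i _ j _ h => by simpa using h)
  obtain ⟨N, hN⟩ := hfin.bddAbove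
  exact ⟨N + 1, fun n hn h => by have := hN h; omega⟩

lemma raisesDegree_normalForm {p q : ℕ →₀ K[X]} {f : Module.End K K[X]} (hf : f ∈ Fset K)
    {k : ℕ} (hk : 0 < k) (hpk : p k ≠ 0) :
    RaisesDegree (upperPart K p + lowerPart K q + f) := by
  obtain ⟨m, hm, hmax⟩ := p.support.exists_max_image id ⟨k, by simpa using hpk⟩
  have hm0 : 0 < m := hk.trans_le (hmax k (by simpa using hpk))
  obtain ⟨n₁, hn₁⟩ := exists_forall_ge_eval_ne_zero (Finsupp.mem_support_iff.1 hm)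
  obtain ⟨n₂, hn₂⟩ := Fset_eventually_zero hf
  refine ⟨m, hm0, max n₁ n₂, fun n hn => ⟨_, hn₁ n (le_trans (le_max_left _ _) hn), ?_⟩⟩
  have hup : upperPart K p (ep n) = ∑ i ∈ p.support, (p i).eval ((n : K) + 1) • ep (n + i) := by
    rw [upperPart_apply, LinearMap.sum_apply]
    refine Finset.sum_congr rfl fun i _ => ?_
    rw [Module.End.mul_apply, aeval_hOp_divPow, map_smul, intOp_pow_divPow]
  rw [LinearMap.add_apply, LinearMap.add_apply, hn₂ n (le_trans (le_max_right _ _) hn), add_zero,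
    hup, ← Finset.add_sum_erase _ _ hm, add_assoc, add_sub_cancel_left]
  have hep : ∀ j < n + m, ep j ∈ Submodule.span K (ep '' Set.Iio (n + m)) := fun j hj =>
    Submodule.subset_span ⟨j, hj, rfl⟩
  refine add_mem (sum_mem fun i hi => Submodule.smul_mem _ _ (hep _ ?_)) ?_
  · have h1 := Finset.ne_of_mem_erase hi
    have h2 : i ≤ m := hmax i (Finset.mem_of_mem_erase hi)
    omega
  · rw [lowerPart_apply, LinearMap.sum_apply]
    refine sum_mem fun i _ => ?_
    rw [Module.End.mul_apply]
    rcases lt_or_ge n i with h | h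
    · rw [derOp_pow_divPow_of_lt h, map_zero]; exact zero_mem _
    · obtain ⟨j, rfl⟩ := Nat.exists_eq_add_of_le' h
      rw [derOp_pow_divPow_add, aeval_hOp_divPow]
      exact Submodule.smul_mem _ _ (hep _ (by omega))

lemma upperPart_mem_KH {p : ℕ →₀ K[X]} (hp : ∀ k, 0 < k → p k = 0) : upperPart K p ∈ KH K := by
  rw [upperPart_apply]
  refine sum_mem fun i hi => ?_
  rcases Nat.eq_zero_or_pos i with rfl | h
  · simpa only [KH, pow_zero, one_mul, mul_one] using aeval_mem_adjoin_singleton K (hOp K)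
  · exact absurd (hp i h) (Finsupp.mem_support_iff.1 hi)

lemma lowerPart_mem_KH {p : ℕ →₀ K[X]} (hp : ∀ k, 0 < k → p k = 0) : lowerPart K p ∈ KH K := by
  rw [lowerPart_apply]
  refine sum_mem fun i hi => ?_
  rcases Nat.eq_zero_or_pos i with rfl | h
  · simpa only [KH, pow_zero, one_mul, mul_one] using aeval_mem_adjoin_singleton K (hOp K)
  · exact absurd (hp i h) (Finsupp.mem_support_iff.1 hi)

lemma raisesDegree_or_transpose {a : Module.End K K[X]} (haI : a ∈ I1 K)
    (ha : a ∉ Subalgebra.toSubmodule (KH K) ⊔ Fset K) :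
    RaisesDegree a ∨ ∃ b, IsTranspose a b ∧ RaisesDegree b := by
  obtain ⟨p, q, f, hf, rfl⟩ := exists_normalForm haI
  by_cases hp : ∃ k, 0 < k ∧ p k ≠ 0
  · obtain ⟨k, hk, hpk⟩ := hp
    exact Or.inl (raisesDegree_normalForm hf hk hpk)
  by_cases hq : ∃ k, 0 < k ∧ q k ≠ 0
  · obtain ⟨k, hk, hqk⟩ := hq
    obtain ⟨g, hg, hfg⟩ := exists_isTranspose_of_mem_Fset hf
    refine Or.inr ⟨upperPart K q + lowerPart K p + g, ?_, raisesDegree_normalForm hg hk hqk⟩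
    rw [add_comm (upperPart K q)]
    exact ((isTranspose_upperPart p).add (isTranspose_upperPart q).symm).add hfg
  push Not at hp hq
  exact absurd (Submodule.mem_sup.2
    ⟨_, add_mem (upperPart_mem_KH hp) (lowerPart_mem_KH hq), f, hf, rfl⟩) ha

lemma RaisesDegree.exists_generating {a : Module.End K K[X]} (ha : RaisesDegree a) :
    ∃ N, ∀ L : Submodule K K[X], (∀ v ∈ L, a v ∈ L) → (∀ i < N, ep i ∈ L) → L = ⊤ := by
  obtain ⟨m, hm, n₀, h⟩ := ha
  refine ⟨n₀ + m, fun L hL hN => ?_⟩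
  have key : ∀ n, ep n ∈ L := by
    intro n
    induction n using Nat.strong_induction_on with
    | _ n ih =>
      rcases lt_or_ge n (n₀ + m) with hn | hn
      · exact hN n hn
      obtain ⟨k, rfl⟩ := Nat.exists_eq_add_of_le' (show m ≤ n by omega)
      obtain ⟨c, hc, hk⟩ := h k (by omega)
      have hsub : Submodule.span K (ep '' Set.Iio (k + m)) ≤ L :=
        Submodule.span_le.2 (by rintro _ ⟨j, hj, rfl⟩; exact ih j hj)
      have h1 := sub_mem (hL _ (ih k (by omega))) (hsub hk)
      rw [sub_sub_cancel] at h1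
      exact (Submodule.smul_mem_iff _ hc).1 h1
  rw [eq_top_iff, ← (divPowBasis K).span_eq]
  exact Submodule.span_le.2 (by rintro _ ⟨j, rfl⟩; exact key j)

lemma RaisesDegree.exists_generators {a : Module.End K K[X]} (ha : RaisesDegree a)
    (C : Submodule K (Module.End K K[X])) (hmul : ∀ c ∈ C, a * c ∈ C)
    (hcomm : ∀ c ∈ C, a * c = c * a) :
    ∃ (n : ℕ) (g : Fin n → Module.End K K[X]), (∀ i, g i ∈ C) ∧
      ∀ c ∈ C, ∃ p : Fin n → K[X], c = ∑ i, aeval a (p i) * g i := by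
  obtain ⟨N, hN⟩ := ha.exists_generating
  let φ := Module.AEval'.of a
  have hsmul : ∀ (p : K[X]) (v : K[X]), p • φ v = φ (aeval a p v) := fun p v =>
    (Module.AEval.of_aeval_smul a p v).symm
  have haeval : ∀ c ∈ C, ∀ p : K[X], aeval a p * c ∈ C := by
    intro c hc p
    induction p using Polynomial.induction_on' with
    | add p q hp hq => rw [map_add, add_mul]; exact add_mem hp hq
    | monomial k r =>
      rw [aeval_monomial, mul_assoc, ← Algebra.smul_def]
      refine Submodule.smul_mem _ _ ?_
      induction k with
      | zero => simpa using hc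
      | succ k ih => rw [pow_succ', mul_assoc]; exact hmul _ ih
  have hfin : Module.Finite K[X] (Module.AEval' a) := by
    refine ⟨Submodule.fg_iff_exists_fin_generating_family.2 ⟨N, fun i => φ (ep i), ?_⟩⟩
    set S := Submodule.span K[X] (Set.range fun i : Fin N => φ (ep i))
    have h := hN ((S.restrictScalars K).comap φ.toLinearMap)
      (fun v hv => by
        have hXv : (X : K[X]) • φ v ∈ S := S.smul_mem X hv
        rw [hsmul, aeval_X] at hXv
        exact hXv)
      (fun i hi => (Submodule.subset_span ⟨⟨i, hi⟩, rfl⟩ : φ (ep i) ∈ S))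
    rw [eq_top_iff]
    intro w _
    have hw : φ.symm w ∈ (S.restrictScalars K).comap φ.toLinearMap := by rw [h]; trivial
    have : φ (φ.symm w) ∈ S := hw
    rwa [LinearEquiv.apply_symm_apply] at this
  have hnoeth : IsNoetherian K[X] (Module.AEval' a) :=
    isNoetherian_of_isNoetherianRing_of_finite _ _
  let ev : Submodule K[X] (Fin N → Module.AEval' a) :=
    { carrier := {v | ∃ c ∈ C, v = fun i : Fin N => φ (c (ep i))}
      add_mem' := by
        rintro _ _ ⟨c, hc, rfl⟩ ⟨d, hd, rfl⟩
        exact ⟨c + d, add_mem hc hd, by ext i; simp⟩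
      zero_mem' := ⟨0, zero_mem _, by ext i; simp⟩
      smul_mem' := by
        rintro p _ ⟨c, hc, rfl⟩
        exact ⟨_, haeval c hc p, by ext i; simp [hsmul]⟩ }
  obtain ⟨n, s, hs⟩ := Submodule.fg_iff_exists_fin_generating_family.1 (IsNoetherian.noetherian ev)
  have hsmem : ∀ i, ∃ c ∈ C, s i = fun j : Fin N => φ (c (ep j)) := fun i =>
    show s i ∈ ev from hs ▸ Submodule.subset_span ⟨i, rfl⟩
  choose g hgC hg using hsmem
  refine ⟨n, g, hgC, fun c hc => ?_⟩
  have hcs : (fun j : Fin N => φ (c (ep j))) ∈ Submodule.span K[X] (Set.range s) := by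
    rw [hs]; exact ⟨c, hc, rfl⟩
  obtain ⟨p, hp⟩ := (Submodule.mem_span_range_iff_exists_fun _).1 hcs
  refine ⟨p, ?_⟩
  have hdC : c - ∑ i, aeval a (p i) * g i ∈ C :=
    sub_mem hc (sum_mem fun i _ => haeval _ (hgC i) _)
  rw [← sub_eq_zero, ← LinearMap.ker_eq_top]
  refine hN _ (fun v hv => ?_) (fun i hi => ?_)
  · rw [LinearMap.mem_ker] at hv ⊢
    rw [← Module.End.mul_apply, ← hcomm _ hdC, Module.End.mul_apply, hv, map_zero]
  · have hi' := congrFun hp ⟨i, hi⟩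
    rw [LinearMap.mem_ker, LinearMap.sub_apply, sub_eq_zero]
    apply φ.injective
    rw [← hi', LinearMap.sum_apply, map_sum, Finset.sum_apply]
    refine (Finset.sum_congr rfl fun j _ => ?_)
    rw [Pi.smul_apply, hg, hsmul, Module.End.mul_apply]

lemma mem_Cen_iff {a c : Module.End K K[X]} : c ∈ Cen K a ↔ c ∈ I1 K ∧ a * c = c * a := by
  simp [Cen, Algebra.mem_inf, Subalgebra.mem_centralizer_iff]

lemma Cen_exists_generators {a : Module.End K K[X]} (haI : a ∈ I1 K)
    (ha : a ∉ Subalgebra.toSubmodule (KH K) ⊔ Fset K) :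
    ∃ (n : ℕ) (g : Fin n → Module.End K K[X]), (∀ i, g i ∈ Cen K a) ∧
      ∀ c ∈ Cen K a, ∃ p : Fin n → K[X], c = ∑ i, aeval a (p i) * g i := by
  have haC : a ∈ Cen K a := mem_Cen_iff.2 ⟨haI, rfl⟩
  rcases raisesDegree_or_transpose haI ha with h | ⟨b, hab, hb⟩
  · exact h.exists_generators (Subalgebra.toSubmodule (Cen K a))
      (fun c hc => (Cen K a).mul_mem haC hc) (fun c hc => (mem_Cen_iff.1 hc).2)
  let C : Submodule K (Module.End K K[X]) :=
    { carrier := {d | ∃ c ∈ Cen K a, IsTranspose c d}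
      add_mem' := by
        rintro _ _ ⟨c, hc, h⟩ ⟨c', hc', h'⟩
        exact ⟨_, add_mem hc hc', h.add h'⟩
      zero_mem' := ⟨0, zero_mem _, IsTranspose.zero⟩
      smul_mem' := by
        rintro r _ ⟨c, hc, h⟩
        exact ⟨_, Subalgebra.smul_mem _ hc r, h.smul r⟩ }
  obtain ⟨n, g', hg', hgen⟩ := hb.exists_generators C
    (by rintro d ⟨c, hc, h⟩; exact ⟨_, mul_mem hc haC, h.mul hab⟩)
    (by
      rintro d ⟨c, hc, h⟩
      have h1 := hab.mul h
      rw [(mem_Cen_iff.1 hc).2] at h1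
      exact (h.mul hab).right_unique h1)
  choose g hg hgg' using hg'
  refine ⟨n, g, hg, fun c hc => ?_⟩
  obtain ⟨d, hd⟩ := exists_isTranspose (mem_Cen_iff.1 hc).1
  obtain ⟨p, rfl⟩ := hgen d ⟨c, hc, hd⟩
  refine ⟨p, hd.left_unique (IsTranspose.sum fun i _ => ?_)⟩
  have hcomm : Commute (aeval a (p i)) (g i) := by
    exact commute_aeval_of_commute (mem_Cen_iff.1 (hg i)).2 _
  rw [hcomm.eq]
  exact (hgg' i).mul (hab.aeval _)

end Centralizers

/-- if `a ∈ I₁` and `a ∉ K[H] + F`, then `Cen_{I₁}(a)` is a finitely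
generated `K[a]`-module; in particular it is a finitely generated `K`-algebra which is
left and right Noetherian. -/
theorem statement14 (a : Module.End K (Polynomial K)) (haI : a ∈ I1 K)
    (ha : a ∉ Subalgebra.toSubmodule (KH K) ⊔ Fset K) :
    (∃ (n : ℕ) (g : Fin n → Module.End K (Polynomial K)),
        (∀ i, g i ∈ Cen K a) ∧
        ∀ c ∈ Cen K a, ∃ p : Fin n → Polynomial K,
          c = ∑ i, Polynomial.aeval a (p i) * g i)
    ∧ (Cen K a).FG
    ∧ IsNoetherianRing (Cen K a)
    ∧ IsNoetherianRing ((Cen K a)ᵐᵒᵖ) := by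
  obtain ⟨n, g, hg, hgen⟩ := Cen_exists_generators haI ha
  have haC : a ∈ Cen K a := mem_Cen_iff.2 ⟨haI, rfl⟩
  have hgen' : ∀ c : Cen K a, ∃ p : Fin n → K[X],
      c = ∑ i, aeval (⟨a, haC⟩ : Cen K a) (p i) * ⟨g i, hg i⟩ := by
    rintro ⟨c, hc⟩
    obtain ⟨p, hp⟩ := hgen c hc
    refine ⟨p, Subtype.ext ?_⟩
    simp [hp]
  have hcomm : ∀ c : Cen K a, Commute (⟨a, haC⟩ : Cen K a) c := fun c =>
    Subtype.ext (mem_Cen_iff.1 c.2).2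
  refine ⟨⟨n, g, hg, hgen⟩, fg_of_aeval_generators haC hg hgen, ?_, ?_⟩
  · exact isNoetherianRing_of_aeval_generators (k := K) (R := Cen K a) (α := ⟨a, haC⟩)
      (g := fun i => ⟨g i, hg i⟩) hgen'
  · exact isNoetherianRing_op_of_aeval_generators (k := K) (R := Cen K a) (α := ⟨a, haC⟩) hcomm
      (g := fun i => ⟨g i, hg i⟩) hgen'

end
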